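/- arXiv:hep-th/9801116 — 4 statements merged into one kernel-verified Lean document; each statement's English description precedes it below -/
import Mathlib

section
/- For every n×n complex symmetric matrix 𝒩 whose imaginary part Im 𝒩 is invertible, the real 2n×2n block matrix M(𝒩) with blocks A = Im 𝒩 + Re 𝒩 (Im 𝒩)⁻¹ Re 𝒩, B = −Re 𝒩 (Im 𝒩)⁻¹, C = −(Im 𝒩)⁻¹ Re 𝒩, D = (Im 𝒩)⁻¹ (arranged as M = [[A,B],[C,D]]) is symmetric and symplectic: Mᵀ Ω M = Ω, where Ω = [[0, −1ₙ],[1ₙ, 0]] is the standard symplectic form. -/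
open Matrix

section KineticMatrix

variable {m R : Type*} [Fintype m] [DecidableEq m] [CommRing R]

theorem isSymm_fromBlocks_kinetic {X Y : Matrix m m R} (hX : X.IsSymm) (hY : Y.IsSymm) :
    (fromBlocks (Y + X * Y⁻¹ * X) (-(X * Y⁻¹)) (-(Y⁻¹ * X)) Y⁻¹).IsSymm := by
  simp [IsSymm, fromBlocks_transpose, transpose_nonsing_inv, hX.eq, hY.eq, Matrix.mul_assoc]

theorem fromBlocks_kinetic_mul_J_mul_self {X Y : Matrix m m R} (hY : IsUnit Y.det) :
    fromBlocks (Y + X * Y⁻¹ * X) (-(X * Y⁻¹)) (-(Y⁻¹ * X)) Y⁻¹ * J m R *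
      fromBlocks (Y + X * Y⁻¹ * X) (-(X * Y⁻¹)) (-(Y⁻¹ * X)) Y⁻¹ = J m R := by
  have h₁ : Y * Y⁻¹ = 1 := mul_nonsing_inv Y hY
  have h₂ : Y⁻¹ * Y = 1 := nonsing_inv_mul Y hY
  have h₃ : Y * (Y⁻¹ * X) = X := by rw [← Matrix.mul_assoc, h₁, Matrix.one_mul]
  simp [J, fromBlocks_multiply, Matrix.mul_add, Matrix.add_mul, Matrix.mul_assoc, h₁, h₂, h₃]

end KineticMatrix

/-- For every `n × n` complex symmetric matrix `𝒩` whose imaginary part is invertible,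
the real `2n × 2n` block matrix `M(𝒩)` with blocks
`A = Im 𝒩 + Re 𝒩 (Im 𝒩)⁻¹ Re 𝒩`, `B = −Re 𝒩 (Im 𝒩)⁻¹`,
`C = −(Im 𝒩)⁻¹ Re 𝒩`, `D = (Im 𝒩)⁻¹` is symmetric and symplectic:
`Mᵀ Ω M = Ω` where `Ω = [[0, −1],[1, 0]]`. -/
theorem symplectic_matrix_of_kinetic_matrix {n : ℕ}
    (𝒩 : Matrix (Fin n) (Fin n) ℂ) (hsym : 𝒩ᵀ = 𝒩)
    (hinv : IsUnit (𝒩.map Complex.im).det) :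
    let ReN : Matrix (Fin n) (Fin n) ℝ := 𝒩.map Complex.re
    let ImN : Matrix (Fin n) (Fin n) ℝ := 𝒩.map Complex.im
    let M : Matrix (Fin n ⊕ Fin n) (Fin n ⊕ Fin n) ℝ :=
      Matrix.fromBlocks (ImN + ReN * ImN⁻¹ * ReN) (-(ReN * ImN⁻¹))
        (-(ImN⁻¹ * ReN)) ImN⁻¹
    let Ω : Matrix (Fin n ⊕ Fin n) (Fin n ⊕ Fin n) ℝ :=
      Matrix.fromBlocks 0 (-1) 1 0
    Mᵀ = M ∧ Mᵀ * Ω * M = Ω := by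
  intro ReN ImN M Ω
  have hRe : ReN.IsSymm := IsSymm.map hsym Complex.re
  have hIm : ImN.IsSymm := IsSymm.map hsym Complex.im
  have hM : Mᵀ = M := isSymm_fromBlocks_kinetic hRe hIm
  refine ⟨hM, ?_⟩
  rw [hM]
  exact fromBlocks_kinetic_mul_J_mul_self hinv
end

section
/- Let Z be an 8×8 antisymmetric complex matrix and let ξ_{ABCD} (A,B,C,D ∈ {1,…,8}) be a totally antisymmetric complex tensor satisfying the reality constraint ξ_{ABCD} = (1/24) Σ_{E,F,G,H} ε_{ABCDEFGH} · conj(ξ_{EFGH}). Define the variation (δZ)_{AB} = (1/2) Σ_{C,D} ξ_{ABCD} · conj(Z_{CD}) (which is again antisymmetric). Then the real-valued quantity Q(Z) = 4 Tr(A(Z)²) − (Tr A(Z))² + 32 Re(Pf Z) is invariant to first order: d/dt Q(Z + t·δZ) |_{t=0} = 0, where t is a real parameter. (This is the statement that S = (1/2)√Q is the moduli-independent E₇(₋₇) invariant of N=8 supergravity.) -/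
open Matrix

/-- The totally antisymmetric Levi-Civita symbol on `n` indices, with
`ε^{1…n} = 1` (value on the identity arrangement) and vanishing on
non-injective index arrangements. -/
noncomputable def epsSign {n : ℕ} (v : Fin n → Fin n) : ℤ :=
  if h : Function.Bijective v then Equiv.Perm.sign (Equiv.ofBijective v h) else 0

/-- The Pfaffian of an 8×8 matrix:
`Pf Z = (1/(2⁴·4!)) Σ ε^{A₁…A₈} Z_{A₁A₂} Z_{A₃A₄} Z_{A₅A₆} Z_{A₇A₈}`. -/
noncomputable def Pf (Z : Matrix (Fin 8) (Fin 8) ℂ) : ℂ :=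
  (1 / (2 ^ 4 * Nat.factorial 4) : ℂ) * ∑ a : Fin 8 → Fin 8,
    (epsSign a : ℂ) * Z (a 0) (a 1) * Z (a 2) (a 3) * Z (a 4) (a 5) * Z (a 6) (a 7)

/-- `A(Z)_A{}^B = Σ_C Z_{AC} · conj(Z_{CB})`, i.e. `A(Z) = Z · conj(Z)`. -/
noncomputable def Amat (Z : Matrix (Fin 8) (Fin 8) ℂ) : Matrix (Fin 8) (Fin 8) ℂ :=
  Z * Z.map (starRingEnd ℂ)

/-- The real quartic quantity `Q(Z) = 4 Tr(A(Z)²) − (Tr A(Z))² + 32 Re(Pf Z)`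
(whose square root is twice the `N = 8` entropy invariant `S`). -/
noncomputable def Q (Z : Matrix (Fin 8) (Fin 8) ℂ) : ℝ :=
  (4 * (Amat Z * Amat Z).trace - (Amat Z).trace ^ 2).re + 32 * (Pf Z).re

section LeviCivita

variable {n : ℕ}

lemma epsSign_eq_det (a : Fin n → Fin n) :
    (epsSign a : ℂ) = ((1 : Matrix (Fin n) (Fin n) ℂ).submatrix id a).det := by
  unfold epsSign
  split_ifs with h
  · have := Matrix.det_permute' (Equiv.ofBijective a h) (1 : Matrix (Fin n) (Fin n) ℂ)
    rw [Matrix.det_one, mul_one] at this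
    exact this.symm
  · have hinj : ¬ Function.Injective a := fun hi => h (Finite.injective_iff_bijective.mp hi)
    simp only [Function.Injective, not_forall] at hinj
    obtain ⟨i, j, hij, hne⟩ := hinj
    rw [Matrix.det_zero_of_column_eq hne (fun k => by simp [Matrix.submatrix_apply, hij, Matrix.one_apply])]
    simp

lemma epsSign_comp_perm (a : Fin n → Fin n) (σ : Equiv.Perm (Fin n)) :
    (epsSign (a ∘ σ) : ℂ) = (Equiv.Perm.sign σ : ℤ) * (epsSign a : ℂ) := by
  rw [epsSign_eq_det, epsSign_eq_det, ← Matrix.det_permute']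
  rfl

/-- Antisymmetrising over `n + 1` indices in dimension `n` gives zero. -/
lemma epsSign_schouten (a : Fin n → Fin n) (i k : Fin n) :
    ∑ p, (if k = a p then (epsSign (Function.update a p i) : ℂ) else 0) =
      if k = i then (epsSign a : ℂ) else 0 := by
  have h := congrFun (Matrix.mulVec_cramer ((1 : Matrix (Fin n) (Fin n) ℂ).submatrix id a)
    (Pi.single i 1)) k
  have hc : ∀ p, Matrix.cramer ((1 : Matrix (Fin n) (Fin n) ℂ).submatrix id a)
      (Pi.single i 1) p = (epsSign (Function.update a p i) : ℂ) := by
    intro p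
    rw [Matrix.cramer_apply, epsSign_eq_det]
    congr 1
    ext r s
    by_cases hs : s = p
    · subst hs
      simp [Matrix.one_apply, Pi.single_apply]
    · simp [Matrix.one_apply, hs]
  simpa [Matrix.mulVec, dotProduct, hc, Matrix.one_apply, Pi.single_apply, ← epsSign_eq_det]
    using h

/-- Full contraction of a function of `n` indices with the Levi-Civita symbol. -/
noncomputable def epsContract (f : (Fin n → Fin n) → ℂ) : ℂ := ∑ a, (epsSign a : ℂ) * f a

lemma epsContract_comp_perm (f : (Fin n → Fin n) → ℂ) (σ : Equiv.Perm (Fin n)) :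
    epsContract (fun a => f (a ∘ σ)) = (Equiv.Perm.sign σ : ℤ) * epsContract f := by
  unfold epsContract
  rw [← Equiv.sum_comp (Equiv.arrowCongr σ (Equiv.refl (Fin n)))
    (fun a => (epsSign a : ℂ) * f (a ∘ σ)), Finset.mul_sum]
  refine Finset.sum_congr rfl fun a _ => ?_
  have h1 : (Equiv.arrowCongr σ (Equiv.refl (Fin n))) a = a ∘ σ.symm := rfl
  have h2 : (a ∘ σ.symm) ∘ σ = a := by ext; simp
  rw [h1, h2, epsSign_comp_perm, Equiv.Perm.sign_symm, mul_assoc]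

lemma epsContract_const_mul (c : ℂ) (f : (Fin n → Fin n) → ℂ) :
    epsContract (fun a => c * f a) = c * epsContract f := by
  simp only [epsContract, Finset.mul_sum]
  exact Finset.sum_congr rfl fun a _ => by ring

lemma epsContract_congr_perm {f g : (Fin n → Fin n) → ℂ} (σ : Equiv.Perm (Fin n))
    (h : ∀ a, f a = (Equiv.Perm.sign σ : ℤ) * g (a ∘ σ)) : epsContract f = epsContract g := by
  rw [funext h, epsContract_const_mul, epsContract_comp_perm, ← mul_assoc, ← Int.cast_mul,
    Int.units_coe_mul_self, Int.cast_one, one_mul]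

lemma epsContract_neg (f : (Fin n → Fin n) → ℂ) :
    epsContract (fun a => - f a) = - epsContract f := by
  simp [epsContract]

lemma conj_epsContract (f : (Fin n → Fin n) → ℂ) :
    (starRingEnd ℂ) (epsContract f) = epsContract fun a => (starRingEnd ℂ) (f a) := by
  simp [epsContract]

/-- Exchange of the value of `a` at `p` with an extra index. -/
lemma sum_update_exchange (p : Fin n) (f : (Fin n → Fin n) → Fin n → ℂ) :
    ∑ a, ∑ i, f a i = ∑ a : Fin n → Fin n, ∑ i, f (Function.update a p i) (a p) := by
  rw [← Fintype.sum_prod_type', ← Fintype.sum_prod_type']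
  let e : ((Fin n → Fin n) × Fin n) → ((Fin n → Fin n) × Fin n) :=
    fun x => (Function.update x.1 p x.2, x.1 p)
  have he : Function.Involutive e := fun x => by simp [e]
  exact (Equiv.sum_comp he.toPerm (fun x => f x.1 x.2)).symm

/-- A contracted pair of indices may be exchanged in turn with every index of the
Levi-Civita symbol. -/
lemma epsContract_exchange (g : (Fin n → Fin n) → Fin n → Fin n → ℂ) :
    epsContract (fun a => ∑ i, g a i i) =
      ∑ p, epsContract fun a => ∑ i, g (Function.update a p i) (a p) i := by
  have hL : epsContract (fun a => ∑ i, g a i i) =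
      ∑ a, ∑ i, ∑ k, (if k = i then (epsSign a : ℂ) else 0) * g a i k := by
    simp [epsContract, Finset.mul_sum]
  have hR : ∀ p, (epsContract fun a => ∑ i, g (Function.update a p i) (a p) i) =
      ∑ a, ∑ i, ∑ k, (if k = a p then (epsSign (Function.update a p i) : ℂ) else 0) *
        g a i k := by
    intro p
    rw [sum_update_exchange p]
    simp [epsContract, Finset.mul_sum]
  simp only [hL, hR]
  symm
  rw [Finset.sum_comm]
  refine Finset.sum_congr rfl fun a _ => ?_
  rw [Finset.sum_comm]
  refine Finset.sum_congr rfl fun i _ => ?_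
  rw [Finset.sum_comm]
  refine Finset.sum_congr rfl fun k _ => ?_
  rw [← epsSign_schouten, Finset.sum_mul]

end LeviCivita

lemma sum_fun_succ {α : Type*} [Fintype α] {n : ℕ} (f : (Fin (n + 1) → α) → ℂ) :
    ∑ a, f a = ∑ x, ∑ b : Fin n → α, f (Matrix.vecCons x b) := by
  rw [← Fintype.sum_prod_type', ← Equiv.sum_comp (Fin.consEquiv fun _ => α)]
  rfl

lemma epsContract_eight (f : (Fin 8 → Fin 8) → ℂ) :
    epsContract f = ∑ A, ∑ B, ∑ C, ∑ D, ∑ E, ∑ F, ∑ G, ∑ H,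
      (epsSign ![A, B, C, D, E, F, G, H] : ℂ) * f ![A, B, C, D, E, F, G, H] := by
  simp only [epsContract, sum_fun_succ, Fintype.sum_unique]
  rfl

section Pfaffian

variable {X Z : Matrix (Fin 8) (Fin 8) ℂ} {η : Fin 8 → Fin 8 → Fin 8 → Fin 8 → ℂ}

lemma sum_mul_sum_contract (X Z : Matrix (Fin 8) (Fin 8) ℂ) (c : ℂ) (b : Fin 8)
    (e : Fin 8 → ℂ) :
    ∑ i, c * X i b * ∑ j, e j * Z i j = c * ∑ j, (Xᵀ * Z) b j * e j := by
  simp only [Matrix.mul_apply, Matrix.transpose_apply, Finset.mul_sum, Finset.sum_mul]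
  rw [Finset.sum_comm]
  exact Finset.sum_congr rfl fun _ _ => Finset.sum_congr rfl fun _ _ => by ring

/-- First exchange: a contraction of `Z` with `η` moves onto the factors `X`. -/
lemma epsContract_exchange_first (hX : ∀ A B, X B A = -X A B)
    (h₁ : ∀ A B C D, η B A C D = -η A B C D) (h₂ : ∀ A B C D, η A C B D = -η A B C D) :
    epsContract (fun a => X (a 0) (a 1) * X (a 2) (a 3) * X (a 4) (a 5) *
        ∑ I, ∑ J, η (a 6) (a 7) I J * Z I J) =
      2 * epsContract (fun a => X (a 2) (a 3) * X (a 4) (a 5) *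
        ∑ J, (Xᵀ * Z) (a 1) J * η (a 6) (a 7) (a 0) J) := by
  set S := epsContract (fun a => X (a 0) (a 1) * X (a 2) (a 3) * X (a 4) (a 5) *
        ∑ I, ∑ J, η (a 6) (a 7) I J * Z I J) with hS
  set U := epsContract (fun a => X (a 2) (a 3) * X (a 4) (a 5) *
        ∑ J, (Xᵀ * Z) (a 1) J * η (a 6) (a 7) (a 0) J) with hU
  have key := epsContract_exchange (n := 8) (fun a I K =>
    X (a 0) (a 1) * X (a 2) (a 3) * X (a 4) (a 5) * ∑ J, η (a 6) (a 7) I J * Z K J)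
  simp only [← Finset.mul_sum] at key
  rw [← hS, Fin.sum_univ_eight] at key
  simp at key
  have t0 : (epsContract fun a => ∑ I, X I (a 1) * X (a 2) (a 3) * X (a 4) (a 5) *
      ∑ J, η (a 6) (a 7) (a 0) J * Z I J) = U := by
    refine epsContract_congr_perm 1 fun a => ?_
    have h := sum_mul_sum_contract X Z (X (a 2) (a 3) * X (a 4) (a 5)) (a 1)
      (fun J => η (a 6) (a 7) (a 0) J)
    simp at h ⊢
    rw [← h]
    exact Finset.sum_congr rfl fun I _ => by ring
  have t1 : (epsContract fun a => ∑ I, X (a 0) I * X (a 2) (a 3) * X (a 4) (a 5) *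
      ∑ J, η (a 6) (a 7) (a 1) J * Z I J) = U := by
    refine epsContract_congr_perm (Equiv.swap 0 1) fun a => ?_
    have h := sum_mul_sum_contract X Z (-(X (a 2) (a 3) * X (a 4) (a 5))) (a 0)
      (fun J => η (a 6) (a 7) (a 1) J)
    simp [Equiv.Perm.sign_swap', Equiv.swap_apply_def] at h ⊢
    rw [← h, ← Finset.sum_neg_distrib]
    exact Finset.sum_congr rfl fun I _ => by
      rw [hX I (a 0)]
      ring
  have t2 : (epsContract fun a => ∑ I, X (a 0) (a 1) * X I (a 3) * X (a 4) (a 5) *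
      ∑ J, η (a 6) (a 7) (a 2) J * Z I J) = U := by
    refine epsContract_congr_perm (Equiv.swap 0 2 * Equiv.swap 1 3) fun a => ?_
    have h := sum_mul_sum_contract X Z (X (a 0) (a 1) * X (a 4) (a 5)) (a 3)
      (fun J => η (a 6) (a 7) (a 2) J)
    simp [Equiv.Perm.sign_swap', Equiv.swap_apply_def] at h ⊢
    rw [← h]
    exact Finset.sum_congr rfl fun I _ => by ring
  have t3 : (epsContract fun a => ∑ I, X (a 0) (a 1) * X (a 2) I * X (a 4) (a 5) *
      ∑ J, η (a 6) (a 7) (a 3) J * Z I J) = U := by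
    refine epsContract_congr_perm (Equiv.swap 0 2 * Equiv.swap 1 3 * Equiv.swap 0 1) fun a => ?_
    have h := sum_mul_sum_contract X Z (-(X (a 0) (a 1) * X (a 4) (a 5))) (a 2)
      (fun J => η (a 6) (a 7) (a 3) J)
    simp [Equiv.Perm.sign_swap', Equiv.swap_apply_def] at h ⊢
    rw [← h, ← Finset.sum_neg_distrib]
    exact Finset.sum_congr rfl fun I _ => by
      rw [hX I (a 2)]
      ring
  have t4 : (epsContract fun a => ∑ I, X (a 0) (a 1) * X (a 2) (a 3) * X I (a 5) *
      ∑ J, η (a 6) (a 7) (a 4) J * Z I J) = U := by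
    refine epsContract_congr_perm (Equiv.swap 0 4 * Equiv.swap 1 5) fun a => ?_
    have h := sum_mul_sum_contract X Z (X (a 2) (a 3) * X (a 0) (a 1)) (a 5)
      (fun J => η (a 6) (a 7) (a 4) J)
    simp [Equiv.Perm.sign_swap', Equiv.swap_apply_def] at h ⊢
    rw [← h]
    exact Finset.sum_congr rfl fun I _ => by ring
  have t5 : (epsContract fun a => ∑ I, X (a 0) (a 1) * X (a 2) (a 3) * X (a 4) I *
      ∑ J, η (a 6) (a 7) (a 5) J * Z I J) = U := by
    refine epsContract_congr_perm (Equiv.swap 0 4 * Equiv.swap 1 5 * Equiv.swap 0 1) fun a => ?_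
    have h := sum_mul_sum_contract X Z (-(X (a 2) (a 3) * X (a 0) (a 1))) (a 4)
      (fun J => η (a 6) (a 7) (a 5) J)
    simp [Equiv.Perm.sign_swap', Equiv.swap_apply_def] at h ⊢
    rw [← h, ← Finset.sum_neg_distrib]
    exact Finset.sum_congr rfl fun I _ => by
      rw [hX I (a 4)]
      ring
  have t6 : (epsContract fun a => ∑ I, X (a 0) (a 1) * X (a 2) (a 3) * X (a 4) (a 5) *
      ∑ J, η I (a 7) (a 6) J * Z I J) = -S := by
    rw [hS, ← epsContract_neg]
    congr 1
    ext a
    have h : ∀ I J, η I (a 7) (a 6) J = -η (a 6) (a 7) I J := fun I J => by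
      rw [h₁, h₂, h₁, neg_neg]
    simp [h, Finset.mul_sum]
  have t7 : (epsContract fun a => ∑ I, X (a 0) (a 1) * X (a 2) (a 3) * X (a 4) (a 5) *
      ∑ J, η (a 6) I (a 7) J * Z I J) = -S := by
    rw [hS, ← epsContract_neg]
    congr 1
    ext a
    simp [h₂ (a 6) (a 7), Finset.mul_sum]
  rw [t0, t1, t2, t3, t4, t5, t6, t7] at key
  linear_combination key / 3

/-- Second exchange: the remaining contraction closes to a trace or to a product with `X`. -/
lemma epsContract_exchange_second (N : Matrix (Fin 8) (Fin 8) ℂ) (hX : ∀ A B, X B A = -X A B)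
    (h₁ : ∀ A B C D, η B A C D = -η A B C D) (h₂ : ∀ A B C D, η A C B D = -η A B C D)
    (h₃ : ∀ A B C D, η A B D C = -η A B C D) :
    4 * epsContract (fun a => X (a 2) (a 3) * X (a 4) (a 5) *
        ∑ J, N (a 1) J * η (a 6) (a 7) (a 0) J) =
      N.trace * epsContract (fun a => X (a 2) (a 3) * X (a 4) (a 5) *
          η (a 6) (a 7) (a 0) (a 1)) +
        4 * epsContract (fun a => X (a 4) (a 5) * (N * X) (a 1) (a 3) *
          η (a 6) (a 7) (a 0) (a 2)) := by
  set U := epsContract (fun a => X (a 2) (a 3) * X (a 4) (a 5) *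
        ∑ J, N (a 1) J * η (a 6) (a 7) (a 0) J) with hU
  set T := epsContract (fun a => X (a 4) (a 5) * (N * X) (a 1) (a 3) *
          η (a 6) (a 7) (a 0) (a 2)) with hT
  have key := epsContract_exchange (n := 8) (fun a I K =>
    X (a 2) (a 3) * X (a 4) (a 5) * (N (a 1) K * η (a 6) (a 7) (a 0) I))
  simp only [← Finset.mul_sum] at key
  rw [← hU, Fin.sum_univ_eight] at key
  simp at key
  have t0 : (epsContract fun a => ∑ J, X (a 2) (a 3) * X (a 4) (a 5) *
      (N (a 1) J * η (a 6) (a 7) J (a 0))) = -U := by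
    rw [hU, ← epsContract_neg]
    congr 1
    ext a
    simp [h₃ (a 6) (a 7) (a 0), Finset.mul_sum]
  have t1 : (epsContract fun a => ∑ J, X (a 2) (a 3) * X (a 4) (a 5) *
      (N J J * η (a 6) (a 7) (a 0) (a 1))) = N.trace * epsContract (fun a =>
        X (a 2) (a 3) * X (a 4) (a 5) * η (a 6) (a 7) (a 0) (a 1)) := by
    rw [← epsContract_const_mul]
    congr 1
    ext a
    simp only [Matrix.trace, Matrix.diag_apply, Finset.sum_mul]
    exact Finset.sum_congr rfl fun J _ => by ring
  have t2 : (epsContract fun a => ∑ J, X J (a 3) * X (a 4) (a 5) *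
      (N (a 1) J * η (a 6) (a 7) (a 0) (a 2))) = T := by
    refine epsContract_congr_perm 1 fun a => ?_
    simp [Matrix.mul_apply, Finset.mul_sum, Finset.sum_mul]
    exact Finset.sum_congr rfl fun J _ => by ring
  have t3 : (epsContract fun a => ∑ J, X (a 2) J * X (a 4) (a 5) *
      (N (a 1) J * η (a 6) (a 7) (a 0) (a 3))) = T := by
    refine epsContract_congr_perm (Equiv.swap 2 3) fun a => ?_
    simp [Equiv.Perm.sign_swap', Equiv.swap_apply_def,
      Matrix.mul_apply, Finset.mul_sum, Finset.sum_mul]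
    rw [← Finset.sum_neg_distrib]
    exact Finset.sum_congr rfl fun J _ => by
      rw [hX J (a 2)]
      ring
  have t4 : (epsContract fun a => ∑ J, X (a 2) (a 3) * X J (a 5) *
      (N (a 1) J * η (a 6) (a 7) (a 0) (a 4))) = T := by
    refine epsContract_congr_perm (Equiv.swap 2 4 * Equiv.swap 3 5) fun a => ?_
    simp [Equiv.Perm.sign_swap', Equiv.swap_apply_def,
      Matrix.mul_apply, Finset.mul_sum, Finset.sum_mul]
    exact Finset.sum_congr rfl fun J _ => by ring
  have t5 : (epsContract fun a => ∑ J, X (a 2) (a 3) * X (a 4) J *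
      (N (a 1) J * η (a 6) (a 7) (a 0) (a 5))) = T := by
    refine epsContract_congr_perm (Equiv.swap 2 4 * Equiv.swap 3 5 * Equiv.swap 2 3) fun a => ?_
    simp [Equiv.Perm.sign_swap', Equiv.swap_apply_def,
      Matrix.mul_apply, Finset.mul_sum, Finset.sum_mul]
    rw [← Finset.sum_neg_distrib]
    exact Finset.sum_congr rfl fun J _ => by
      rw [hX J (a 4)]
      ring
  have t6 : (epsContract fun a => ∑ J, X (a 2) (a 3) * X (a 4) (a 5) *
      (N (a 1) J * η J (a 7) (a 0) (a 6))) = -U := by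
    rw [hU, ← epsContract_neg]
    congr 1
    ext a
    have h : ∀ J, η J (a 7) (a 0) (a 6) = -η (a 6) (a 7) (a 0) J := fun J => by
      rw [h₁, h₂, h₃, h₂, h₁]
      ring
    simp [h, Finset.mul_sum]
  have t7 : (epsContract fun a => ∑ J, X (a 2) (a 3) * X (a 4) (a 5) *
      (N (a 1) J * η (a 6) J (a 0) (a 7))) = -U := by
    rw [hU, ← epsContract_neg]
    congr 1
    ext a
    have h : ∀ J, η (a 6) J (a 0) (a 7) = -η (a 6) (a 7) (a 0) J := fun J => by
      rw [h₂, h₃, h₂]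
      ring
    simp [h, Finset.mul_sum]
  rw [t0, t1, t2, t3, t4, t5, t6, t7] at key
  linear_combination key

/-- The contraction of `ε X X X` with `η Z`, expressed through contractions of `ε X X η`. -/
lemma epsContract_pfaffian_variation (hX : ∀ A B, X B A = -X A B)
    (h₁ : ∀ A B C D, η B A C D = -η A B C D) (h₂ : ∀ A B C D, η A C B D = -η A B C D)
    (h₃ : ∀ A B C D, η A B D C = -η A B C D) :
    epsContract (fun a => X (a 0) (a 1) * X (a 2) (a 3) * X (a 4) (a 5) *
        ∑ I, ∑ J, η (a 6) (a 7) I J * Z I J) =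
      2 * epsContract (fun a => (X * Z * X) (a 0) (a 1) * X (a 2) (a 3) *
          η (a 4) (a 5) (a 6) (a 7)) -
        (X * Z).trace / 2 * epsContract (fun a => X (a 0) (a 1) * X (a 2) (a 3) *
          η (a 4) (a 5) (a 6) (a 7)) := by
  have hT : Xᵀ = -X := by
    ext i j
    exact hX i j
  have h := epsContract_exchange_second (X := X) (η := η) (Xᵀ * Z) hX h₁ h₂ h₃
  rw [epsContract_exchange_first hX h₁ h₂]
  have hV : epsContract (fun a => X (a 2) (a 3) * X (a 4) (a 5) * η (a 6) (a 7) (a 0) (a 1)) =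
      epsContract (fun a => X (a 0) (a 1) * X (a 2) (a 3) * η (a 4) (a 5) (a 6) (a 7)) := by
    refine epsContract_congr_perm (finRotate 8 * finRotate 8) fun a => ?_
    simp [sign_finRotate]
  have hT' : epsContract (fun a => X (a 4) (a 5) * (Xᵀ * Z * X) (a 1) (a 3) *
        η (a 6) (a 7) (a 0) (a 2)) =
      epsContract (fun a => (X * Z * X) (a 0) (a 1) * X (a 2) (a 3) *
        η (a 4) (a 5) (a 6) (a 7)) := by
    refine epsContract_congr_perm (Equiv.swap 0 1 * Equiv.swap 1 3 * Equiv.swap 3 5 *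
      Equiv.swap 5 7 * Equiv.swap 7 2 * Equiv.swap 2 4 * Equiv.swap 4 6) fun a => ?_
    simp [Equiv.Perm.sign_swap', Equiv.swap_apply_def, hT]
    exact Or.inl (by ring)
  rw [hV, hT'] at h
  rw [hT] at h ⊢
  simp only [neg_mul, Matrix.trace_neg] at h ⊢
  linear_combination h / 2

end Pfaffian

section Derivative

lemma hasDerivAt_mul_apply {M N : ℝ → Matrix (Fin 8) (Fin 8) ℂ}
    {M' N' : Matrix (Fin 8) (Fin 8) ℂ} {t : ℝ}
    (hM : ∀ i j, HasDerivAt (fun s => M s i j) (M' i j) t)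
    (hN : ∀ i j, HasDerivAt (fun s => N s i j) (N' i j) t) (i j : Fin 8) :
    HasDerivAt (fun s => (M s * N s) i j) ((M' * N t + M t * N') i j) t := by
  simp only [Matrix.mul_apply, Matrix.add_apply, ← Finset.sum_add_distrib]
  exact HasDerivAt.fun_sum fun k _ => (hM i k).mul (hN k j)

lemma hasDerivAt_trace {M : ℝ → Matrix (Fin 8) (Fin 8) ℂ} {M' : Matrix (Fin 8) (Fin 8) ℂ}
    {t : ℝ} (hM : ∀ i j, HasDerivAt (fun s => M s i j) (M' i j) t) :
    HasDerivAt (fun s => (M s).trace) M'.trace t :=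
  HasDerivAt.fun_sum fun i _ => hM i i

lemma hasDerivAt_line (z w : ℂ) (t : ℝ) : HasDerivAt (fun s : ℝ => z + (s : ℂ) * w) w t := by
  simpa using ((hasDerivAt_id t).ofReal_comp.mul_const w).const_add z

lemma hasDerivAt_Pf (Z W : Matrix (Fin 8) (Fin 8) ℂ) :
    HasDerivAt (fun t : ℝ => Pf (Z + (t : ℂ) • W))
      (1 / 96 * epsContract fun a =>
        Z (a 0) (a 1) * Z (a 2) (a 3) * Z (a 4) (a 5) * W (a 6) (a 7)) 0 := by
  set P := epsContract fun a => Z (a 0) (a 1) * Z (a 2) (a 3) * Z (a 4) (a 5) * W (a 6) (a 7)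
    with hP
  have h0 : (epsContract fun a =>
      W (a 0) (a 1) * Z (a 2) (a 3) * Z (a 4) (a 5) * Z (a 6) (a 7)) = P := by
    refine epsContract_congr_perm (Equiv.swap 0 6 * Equiv.swap 1 7) fun a => ?_
    simp [Equiv.Perm.sign_swap', Equiv.swap_apply_def]
    ring
  have h2 : (epsContract fun a =>
      Z (a 0) (a 1) * W (a 2) (a 3) * Z (a 4) (a 5) * Z (a 6) (a 7)) = P := by
    refine epsContract_congr_perm (Equiv.swap 2 6 * Equiv.swap 3 7) fun a => ?_
    simp [Equiv.Perm.sign_swap', Equiv.swap_apply_def]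
    ring
  have h4 : (epsContract fun a =>
      Z (a 0) (a 1) * Z (a 2) (a 3) * W (a 4) (a 5) * Z (a 6) (a 7)) = P := by
    refine epsContract_congr_perm (Equiv.swap 4 6 * Equiv.swap 5 7) fun a => ?_
    simp [Equiv.Perm.sign_swap', Equiv.swap_apply_def]
    ring
  have hd := (HasDerivAt.fun_sum (u := Finset.univ) fun (a : Fin 8 → Fin 8) _ =>
    ((((hasDerivAt_line (Z (a 0) (a 1)) (W (a 0) (a 1)) 0).const_mul (epsSign a : ℂ)).fun_mul
      (hasDerivAt_line (Z (a 2) (a 3)) (W (a 2) (a 3)) 0)).fun_mul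
      (hasDerivAt_line (Z (a 4) (a 5)) (W (a 4) (a 5)) 0)).fun_mul
      (hasDerivAt_line (Z (a 6) (a 7)) (W (a 6) (a 7)) 0)).const_mul
    (1 / (2 ^ 4 * Nat.factorial 4) : ℂ)
  refine hd.congr_deriv (Eq.symm ?_)
  have hs : 1 / 96 * P = 1 / (2 ^ 4 * Nat.factorial 4) * (P + P + P + P) := by
    norm_num [Nat.factorial]
    ring
  rw [hs]
  nth_rewrite 1 [← h0]
  nth_rewrite 1 [← h2]
  nth_rewrite 1 [← h4]
  rw [hP]
  simp only [epsContract, ← Finset.sum_add_distrib]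
  congr 1
  refine Finset.sum_congr rfl fun a _ => ?_
  simp
  ring

/-- The derivative of the quartic quantity along a line, as a complex expression. -/
lemma hasDerivAt_Q (Z W : Matrix (Fin 8) (Fin 8) ℂ) :
    HasDerivAt (fun t : ℝ => Q (Z + (t : ℂ) • W))
      (8 * (Amat Z * (W * Z.map (starRingEnd ℂ) + Z * W.map (starRingEnd ℂ))).trace -
        2 * (Amat Z).trace * (W * Z.map (starRingEnd ℂ) + Z * W.map (starRingEnd ℂ)).trace +
        1 / 3 * epsContract fun a =>
          Z (a 0) (a 1) * Z (a 2) (a 3) * Z (a 4) (a 5) * W (a 6) (a 7)).re 0 := by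
  have hL : ∀ i j, HasDerivAt (fun t : ℝ => (Z + (t : ℂ) • W) i j) (W i j) 0 :=
    fun i j => hasDerivAt_line (Z i j) (W i j) 0
  have hC : ∀ i j, HasDerivAt (fun t : ℝ => ((Z + (t : ℂ) • W).map (starRingEnd ℂ)) i j)
      (W.map (starRingEnd ℂ) i j) 0 := fun i j => by
    simpa using hasDerivAt_line ((starRingEnd ℂ) (Z i j)) ((starRingEnd ℂ) (W i j)) 0
  have hA := hasDerivAt_mul_apply hL hC
  have hA2 := hasDerivAt_trace (hasDerivAt_mul_apply hA hA)
  have hF := ((hA2.const_mul 4).fun_sub ((hasDerivAt_trace hA).fun_pow 2)).fun_add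
    ((hasDerivAt_Pf Z W).const_mul 32)
  have hre := (Complex.reCLM.hasFDerivAt.comp_hasDerivAt (0 : ℝ) hF)
  have hQ : (fun t : ℝ => Q (Z + (t : ℂ) • W)) = Complex.reCLM ∘ fun t : ℝ =>
      4 * (Amat (Z + (t : ℂ) • W) * Amat (Z + (t : ℂ) • W)).trace -
        (Amat (Z + (t : ℂ) • W)).trace ^ 2 + 32 * Pf (Z + (t : ℂ) • W) := by
    ext t
    simp [Q]
  rw [hQ]
  refine hre.congr_deriv ?_
  rw [Complex.reCLM_apply]
  congr 1
  simp only [Complex.ofReal_zero, zero_smul, add_zero]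
  rw [Matrix.trace_add (_ * (Z * Z.map (starRingEnd ℂ))),
    Matrix.trace_mul_comm _ (Z * Z.map (starRingEnd ℂ))]
  simp only [Amat]
  push_cast
  ring

end Derivative

/-- Contracting the variation of `Z` with `K`, after dualising `ξ`. -/
lemma sum_mul_variation (Z K : Matrix (Fin 8) (Fin 8) ℂ)
    (ξ : Fin 8 → Fin 8 → Fin 8 → Fin 8 → ℂ)
    (hreal : ∀ A B C D, ξ A B C D =
      (1 / 24 : ℂ) * ∑ E, ∑ F, ∑ G, ∑ H,
        (epsSign ![A, B, C, D, E, F, G, H] : ℂ) * (starRingEnd ℂ) (ξ E F G H)) :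
    ∑ A, ∑ B, K A B * ((1 / 2 : ℂ) * ∑ C, ∑ D, ξ A B C D * (starRingEnd ℂ) (Z C D)) =
      1 / 48 * epsContract fun a => K (a 0) (a 1) * Z.map (starRingEnd ℂ) (a 2) (a 3) *
        (starRingEnd ℂ) (ξ (a 4) (a 5) (a 6) (a 7)) := by
  rw [epsContract_eight]
  simp only [Finset.mul_sum]
  refine Finset.sum_congr rfl fun A _ => Finset.sum_congr rfl fun B _ =>
    Finset.sum_congr rfl fun C _ => Finset.sum_congr rfl fun D _ => ?_
  rw [hreal]
  simp only [Finset.mul_sum, Finset.sum_mul]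
  refine Finset.sum_congr rfl fun E _ => Finset.sum_congr rfl fun F _ =>
    Finset.sum_congr rfl fun G _ => Finset.sum_congr rfl fun H _ => ?_
  simp
  ring

lemma trace_mul_of_antisymm (K W : Matrix (Fin 8) (Fin 8) ℂ) (hK : Kᵀ = -K) :
    (K * W).trace = -∑ A, ∑ B, K A B * W A B := by
  rw [Matrix.trace_mul_comm, ← Matrix.trace_transpose, Matrix.transpose_mul, hK]
  simp [Matrix.trace, Matrix.mul_apply]

lemma trace_map_conj (M : Matrix (Fin 8) (Fin 8) ℂ) :
    (M.map (starRingEnd ℂ)).trace = (starRingEnd ℂ) M.trace := by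
  simp [Matrix.trace]

/-- For an 8×8 antisymmetric complex matrix `Z` and a totally antisymmetric tensor
`ξ_{ABCD}` satisfying the reality constraint
`ξ_{ABCD} = (1/24) Σ ε_{ABCDEFGH} conj(ξ_{EFGH})`, the quantity
`Q(Z) = 4 Tr(A(Z)²) − (Tr A(Z))² + 32 Re(Pf Z)` is invariant to first order under
the `E₇(₋₇)/SU(8)` variation `(δZ)_{AB} = (1/2) Σ ξ_{ABCD} conj(Z_{CD})`. -/
theorem Q_invariant_under_E7_coset_variation
    (Z : Matrix (Fin 8) (Fin 8) ℂ) (hZ : Zᵀ = -Z)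
    (ξ : Fin 8 → Fin 8 → Fin 8 → Fin 8 → ℂ)
    (hanti₁ : ∀ A B C D, ξ B A C D = -ξ A B C D)
    (hanti₂ : ∀ A B C D, ξ A C B D = -ξ A B C D)
    (hanti₃ : ∀ A B C D, ξ A B D C = -ξ A B C D)
    (hreal : ∀ A B C D, ξ A B C D =
      (1 / 24 : ℂ) * ∑ E, ∑ F, ∑ G, ∑ H,
        (epsSign ![A, B, C, D, E, F, G, H] : ℂ) * (starRingEnd ℂ) (ξ E F G H)) :
    deriv (fun t : ℝ =>
      Q (Z + (t : ℂ) • Matrix.of fun A B =>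
        (1 / 2 : ℂ) * ∑ C, ∑ D, ξ A B C D * (starRingEnd ℂ) (Z C D))) 0 = 0 := by
  rw [(hasDerivAt_Q Z _).deriv]
  set W : Matrix (Fin 8) (Fin 8) ℂ := Matrix.of fun A B =>
    (1 / 2 : ℂ) * ∑ C, ∑ D, ξ A B C D * (starRingEnd ℂ) (Z C D) with hW
  set X := Z.map (starRingEnd ℂ) with hXdef
  have hXT : Xᵀ = -X := by
    rw [hXdef, ← Matrix.transpose_map, hZ]
    ext
    simp
  have hX : ∀ A B, X B A = -X A B := fun A B => congrFun (congrFun hXT A) B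
  have hXX : X.map (starRingEnd ℂ) = Z := by
    ext
    simp [hXdef]
  set Y := epsContract fun a => (X * Z * X) (a 0) (a 1) * X (a 2) (a 3) *
    (starRingEnd ℂ) (ξ (a 4) (a 5) (a 6) (a 7)) with hY
  set V := epsContract fun a => X (a 0) (a 1) * X (a 2) (a 3) *
    (starRingEnd ℂ) (ξ (a 4) (a 5) (a 6) (a 7)) with hV
  set P := epsContract fun a => Z (a 0) (a 1) * Z (a 2) (a 3) * Z (a 4) (a 5) * W (a 6) (a 7)
    with hP
  have hα : (X * Z * X * W).trace = -(1 / 48 * Y) := by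
    rw [trace_mul_of_antisymm _ _ (by simp [Matrix.transpose_mul, hXT, hZ, Matrix.mul_assoc])]
    exact congrArg _ (sum_mul_variation Z _ ξ hreal)
  have hβ : (X * W).trace = -(1 / 48 * V) := by
    rw [trace_mul_of_antisymm _ _ hXT]
    exact congrArg _ (sum_mul_variation Z _ ξ hreal)
  have hPc : (starRingEnd ℂ) P = 1 / 2 * (2 * Y - (X * Z).trace / 2 * V) := by
    rw [hY, hV, ← epsContract_pfaffian_variation (η := fun A B C D => (starRingEnd ℂ) (ξ A B C D))
      hX (fun A B C D => by simp [hanti₁ A B C D]) (fun A B C D => by simp [hanti₂ A B C D])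
      (fun A B C D => by simp [hanti₃ A B C D]), hP, conj_epsContract, ← epsContract_const_mul]
    congr 1
    ext a
    simp [hW, hXdef, Complex.conj_ofNat]
    ring
  have hτ : (Amat Z).trace = (X * Z).trace := Matrix.trace_mul_comm _ _
  have hτc : (starRingEnd ℂ) (X * Z).trace = (X * Z).trace := by
    rw [← trace_map_conj, Matrix.map_mul, hXX, Matrix.trace_mul_comm]
  have h1 : (Amat Z * (W * X)).trace = (X * Z * X * W).trace := by
    rw [← Matrix.mul_assoc, Matrix.trace_mul_comm, Amat]
    simp only [Matrix.mul_assoc, ← hXdef]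
  have h2 : (Amat Z * (Z * W.map (starRingEnd ℂ))).trace =
      (starRingEnd ℂ) (X * Z * X * W).trace := by
    rw [← trace_map_conj, Matrix.map_mul, Matrix.map_mul, Matrix.map_mul, hXX, ← hXdef, Amat]
    simp only [Matrix.mul_assoc, ← hXdef]
  have h3 : (W * X).trace = (X * W).trace := Matrix.trace_mul_comm _ _
  have h4 : (Z * W.map (starRingEnd ℂ)).trace = (starRingEnd ℂ) (X * W).trace := by
    rw [← trace_map_conj, Matrix.map_mul, hXX]
  have hP' := congrArg (starRingEnd ℂ) hPc
  rw [Matrix.mul_add, Matrix.trace_add, Matrix.trace_add, h1, h2, h3, h4, hτ, hα, hβ]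
  simp only [Complex.conj_conj, map_mul, map_sub, map_div₀, map_one, map_ofNat, hτc] at hP'
  rw [hP']
  simp only [map_neg, map_mul, map_div₀, map_one, map_ofNat]
  set τ := (X * Z).trace
  have hw : ∀ w : ℂ, ((starRingEnd ℂ) w - w).re = 0 := fun w => by simp
  refine Eq.trans (congrArg Complex.re ?_) (hw (1 / 6 * Y - 1 / 24 * τ * V))
  simp only [map_sub, map_mul, map_div₀, map_one, map_ofNat, hτc]
  ring
end

section
/- Let Z be a 4×4 antisymmetric complex matrix, Z_I ∈ ℂ (I = 1,…,n), and ξ ∈ ℂ. Define the SU(1,1)/U(1)-coset variations (δZ)_{AB} = (1/2) ξ Σ_{C,D} ε_{ABCD} · conj(Z_{CD}) and (δZ)_I = conj(ξ) · conj(Z_I). Then to first order in a real parameter t: d/dt I₁ |_{t=0} = ξ·conj(I₂) + conj(ξ)·I₂ = 2 Re(ξ · conj(I₂)) and d/dt I₂ |_{t=0} = 2 ξ I₁, where I₁ = (1/2) Σ_{A,B} Z_{AB}·conj(Z_{AB}) − Σ_I Z_I·conj(Z_I) and I₂ = (1/4) Σ ε^{ABCD} Z_{AB} Z_{CD} − Σ_I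 conj(Z_I)², both evaluated along (Z + t·δZ, Z_I + t·(δZ)_I). -/
open Matrix

/-- The Levi-Civita symbol `ε^{ABCD}` on 4 indices with `ε^{1234} = 1`. -/
noncomputable def eps4 (A B C D : Fin 4) : ℤ := epsSign ![A, B, C, D]

/-- The real quadratic `O(6,n)` invariant
`I₁ = (1/2) Σ_{A,B} Z_{AB} conj(Z_{AB}) − Σ_I Z_I conj(Z_I)` of `N = 4` supergravity. -/
noncomputable def I₁ {n : ℕ} (Z : Matrix (Fin 4) (Fin 4) ℂ) (W : Fin n → ℂ) : ℝ :=
  ((1 / 2 : ℂ) * ∑ A, ∑ B, Z A B * (starRingEnd ℂ) (Z A B)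
    - ∑ I, W I * (starRingEnd ℂ) (W I)).re

/-- The complex quadratic `O(6,n)` invariant
`I₂ = (1/4) Σ ε^{ABCD} Z_{AB} Z_{CD} − Σ_I conj(Z_I)²` of `N = 4` supergravity. -/
noncomputable def I₂ {n : ℕ} (Z : Matrix (Fin 4) (Fin 4) ℂ) (W : Fin n → ℂ) : ℂ :=
  (1 / 4 : ℂ) * (∑ A, ∑ B, ∑ C, ∑ D, (eps4 A B C D : ℂ) * Z A B * Z C D)
    - ∑ I, (starRingEnd ℂ) (W I) * (starRingEnd ℂ) (W I)

/-- On four indices the Levi-Civita symbol is a product of signs of comparisons. -/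
theorem eps4_eq_ite (A B C D : Fin 4) :
    eps4 A B C D = if Function.Injective ![A, B, C, D] then
      ∏ j : Fin 4, ∏ i ∈ Finset.Iio j,
        if ![A, B, C, D] i < ![A, B, C, D] j then 1 else -1 else 0 := by
  unfold eps4 epsSign
  by_cases h : Function.Bijective ![A, B, C, D]
  · rw [dif_pos h, if_pos h.injective, Equiv.Perm.sign_eq_prod_prod_Iio]
    simp only [Units.coe_prod, apply_ite Units.val, Units.val_one, Units.val_neg,
      Equiv.ofBijective_apply]
  · rw [dif_neg h, if_neg (fun hi => h (Finite.injective_iff_bijective.mp hi))]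

theorem eps4_swap_pairs (A B C D : Fin 4) : eps4 A B C D = eps4 C D A B := by
  rw [eps4_eq_ite, eps4_eq_ite]
  revert A B C D
  decide +kernel

theorem sum_eps4_mul_eps4 (C D E F : Fin 4) :
    ∑ A, ∑ B, eps4 A B C D * eps4 A B E F =
      2 * ((if C = E then 1 else 0) * (if D = F then 1 else 0)
        - (if C = F then 1 else 0) * (if D = E then 1 else 0)) := by
  simp only [eps4_eq_ite]
  revert C D E F
  decide +kernel

/-- Contracting two Levi-Civita duals of `X` and `Y`, with `Y` antisymmetric. -/
theorem sum_eps4_dual_mul_eps4_dual (X Y : Matrix (Fin 4) (Fin 4) ℂ) (hY : Yᵀ = -Y) :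
    ∑ A, ∑ B, (∑ C, ∑ D, (eps4 A B C D : ℂ) * X C D) * (∑ E, ∑ F, (eps4 A B E F : ℂ) * Y E F) =
      4 * ∑ C, ∑ D, X C D * Y C D := by
  have hc (C D E F : Fin 4) : ∑ A, ∑ B, (eps4 A B C D : ℂ) * eps4 A B E F =
      2 * ((if C = E then 1 else 0) * (if D = F then 1 else 0)
        - (if C = F then 1 else 0) * (if D = E then 1 else 0)) := by
    exact_mod_cast congrArg (Int.cast : ℤ → ℂ) (sum_eps4_mul_eps4 C D E F)
  have hY' (C D : Fin 4) : Y D C = -Y C D := congrFun (congrFun hY C) D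
  calc
    _ = ∑ p : Fin 4 × Fin 4, ∑ q : Fin 4 × Fin 4, ∑ r : Fin 4 × Fin 4,
        (eps4 p.1 p.2 q.1 q.2 * eps4 p.1 p.2 r.1 r.2) * (X q.1 q.2 * Y r.1 r.2) := by
      simp only [Fintype.sum_prod_type, Finset.sum_mul]
      simp only [Finset.mul_sum]
      refine Finset.sum_congr rfl fun A _ => Finset.sum_congr rfl fun B _ =>
        Finset.sum_congr rfl fun C _ => Finset.sum_congr rfl fun D _ =>
        Finset.sum_congr rfl fun E _ => Finset.sum_congr rfl fun F _ => by ring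
    _ = ∑ q : Fin 4 × Fin 4, ∑ r : Fin 4 × Fin 4, (∑ p : Fin 4 × Fin 4,
        (eps4 p.1 p.2 q.1 q.2 : ℂ) * eps4 p.1 p.2 r.1 r.2) * (X q.1 q.2 * Y r.1 r.2) := by
      rw [Finset.sum_comm]
      refine Finset.sum_congr rfl fun q _ => ?_
      rw [Finset.sum_comm]
      simp only [Finset.sum_mul]
    _ = ∑ C, ∑ D, ∑ E, ∑ F, (2 * ((if C = E then 1 else 0) * (if D = F then 1 else 0)
        - (if C = F then 1 else 0) * (if D = E then 1 else 0))) * (X C D * Y E F) := by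
      simp only [Fintype.sum_prod_type, hc]
    _ = ∑ C, ∑ D, 2 * (X C D * Y C D - X C D * Y D C) := by
      refine Finset.sum_congr rfl fun C _ => Finset.sum_congr rfl fun D _ => ?_
      simp [mul_sub, sub_mul, Finset.sum_sub_distrib]
    _ = _ := by
      simp only [Finset.mul_sum]
      refine Finset.sum_congr rfl fun C _ => Finset.sum_congr rfl fun D _ => ?_
      rw [hY' C D]
      ring

theorem hasDerivAt_add_ofReal_mul (a b : ℂ) (t : ℝ) :
    HasDerivAt (fun t : ℝ => a + (t : ℂ) * b) b t := by
  simpa using ((Complex.ofRealCLM.hasDerivAt (x := t)).mul_const b).const_add a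

theorem hasDerivAt_I₁ {n : ℕ} (Z X : Matrix (Fin 4) (Fin 4) ℂ) (W Y : Fin n → ℂ) :
    HasDerivAt (fun t : ℝ => I₁ (Z + (t : ℂ) • X) (W + (t : ℂ) • Y))
      (∑ A, ∑ B, X A B * (starRingEnd ℂ) (Z A B)
        - 2 * ∑ I, Y I * (starRingEnd ℂ) (W I)).re 0 := by
  unfold I₁
  simp only [Matrix.add_apply, Matrix.smul_apply, Pi.add_apply, Pi.smul_apply, smul_eq_mul,
    map_add, map_mul, Complex.conj_ofReal]
  have hd := ((HasDerivAt.fun_sum (u := Finset.univ) fun A _ =>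
      HasDerivAt.fun_sum (u := Finset.univ) fun B _ =>
        (hasDerivAt_add_ofReal_mul (Z A B) (X A B) 0).fun_mul
          (hasDerivAt_add_ofReal_mul ((starRingEnd ℂ) (Z A B)) ((starRingEnd ℂ) (X A B)) 0)
      ).const_mul (1 / 2 : ℂ)).fun_sub
    (HasDerivAt.fun_sum (u := Finset.univ) fun I _ =>
      (hasDerivAt_add_ofReal_mul (W I) (Y I) 0).fun_mul
        (hasDerivAt_add_ofReal_mul ((starRingEnd ℂ) (W I)) ((starRingEnd ℂ) (Y I)) 0))
  refine (Complex.reCLM.hasFDerivAt.comp_hasDerivAt (0 : ℝ) hd).congr_deriv ?_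
  have h2 (a b : ℂ) : (a * (starRingEnd ℂ) b).re = (b * (starRingEnd ℂ) a).re := by
    simp only [Complex.mul_re, Complex.conj_re, Complex.conj_im]
    ring
  simp only [Complex.ofReal_zero, zero_mul, add_zero, Complex.reCLM_apply, Finset.sum_add_distrib,
    Complex.sub_re, Complex.add_re, Complex.re_sum, Complex.mul_re (1 / 2 : ℂ),
    Complex.mul_re (2 : ℂ), h2 (Z _ _) (X _ _), h2 (W _) (Y _)]
  norm_num
  ring

theorem hasDerivAt_I₂ {n : ℕ} (Z X : Matrix (Fin 4) (Fin 4) ℂ) (W Y : Fin n → ℂ) :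
    HasDerivAt (fun t : ℝ => I₂ (Z + (t : ℂ) • X) (W + (t : ℂ) • Y))
      ((1 / 2 : ℂ) * (∑ A, ∑ B, (∑ C, ∑ D, (eps4 A B C D : ℂ) * Z C D) * X A B)
        - 2 * ∑ I, (starRingEnd ℂ) (W I) * (starRingEnd ℂ) (Y I)) 0 := by
  unfold I₂
  simp only [Matrix.add_apply, Matrix.smul_apply, Pi.add_apply, Pi.smul_apply, smul_eq_mul,
    map_add, map_mul, Complex.conj_ofReal]
  have hd := ((HasDerivAt.fun_sum (u := Finset.univ) fun A _ =>
      HasDerivAt.fun_sum (u := Finset.univ) fun B _ =>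
      HasDerivAt.fun_sum (u := Finset.univ) fun C _ =>
      HasDerivAt.fun_sum (u := Finset.univ) fun D _ =>
        ((hasDerivAt_add_ofReal_mul (Z A B) (X A B) 0).const_mul (eps4 A B C D : ℂ)).fun_mul
          (hasDerivAt_add_ofReal_mul (Z C D) (X C D) 0)).const_mul (1 / 4 : ℂ)).fun_sub
    (HasDerivAt.fun_sum (u := Finset.univ) fun I _ =>
      (hasDerivAt_add_ofReal_mul ((starRingEnd ℂ) (W I)) ((starRingEnd ℂ) (Y I)) 0).fun_mul
        (hasDerivAt_add_ofReal_mul ((starRingEnd ℂ) (W I)) ((starRingEnd ℂ) (Y I)) 0))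
  refine hd.congr_deriv ?_
  have hs : ∑ A, ∑ B, ∑ C, ∑ D, (eps4 A B C D : ℂ) * Z A B * X C D =
      ∑ A, ∑ B, ∑ C, ∑ D, (eps4 A B C D : ℂ) * X A B * Z C D := by
    calc
      _ = ∑ p : Fin 4 × Fin 4, ∑ q : Fin 4 × Fin 4,
          (eps4 p.1 p.2 q.1 q.2 : ℂ) * Z p.1 p.2 * X q.1 q.2 := by
        simp only [Fintype.sum_prod_type]
      _ = ∑ q : Fin 4 × Fin 4, ∑ p : Fin 4 × Fin 4,
          (eps4 q.1 q.2 p.1 p.2 : ℂ) * X q.1 q.2 * Z p.1 p.2 := by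
        rw [Finset.sum_comm]
        refine Finset.sum_congr rfl fun q _ => Finset.sum_congr rfl fun p _ => ?_
        rw [eps4_swap_pairs, mul_right_comm]
      _ = _ := by
        simp only [Fintype.sum_prod_type]
  simp only [Complex.ofReal_zero, zero_mul, add_zero, Finset.sum_add_distrib, hs]
  simp only [Finset.sum_mul, mul_right_comm _ (Z _ _) (X _ _), mul_comm ((starRingEnd ℂ) (Y _))]
  ring

/-- Under the `SU(1,1)/U(1)` coset variations
`(δZ)_{AB} = (1/2) ξ Σ ε_{ABCD} conj(Z_{CD})`, `(δZ)_I = conj(ξ) conj(Z_I)`,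
the first-order variations of the `O(6,n)` invariants are
`d I₁/dt |₀ = ξ conj(I₂) + conj(ξ) I₂ = 2 Re(ξ conj(I₂))` and `d I₂/dt |₀ = 2 ξ I₁`. -/
theorem I1_I2_variation_under_SU11_coset {n : ℕ}
    (Z : Matrix (Fin 4) (Fin 4) ℂ) (hZ : Zᵀ = -Z) (W : Fin n → ℂ) (ξ : ℂ) :
    ((deriv (fun t : ℝ =>
      I₁ (Z + (t : ℂ) • Matrix.of fun A B =>
            (1 / 2 : ℂ) * ξ * ∑ C, ∑ D, (eps4 A B C D : ℂ) * (starRingEnd ℂ) (Z C D))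
        (W + (t : ℂ) • fun I => (starRingEnd ℂ) ξ * (starRingEnd ℂ) (W I))) 0 : ℝ) : ℂ)
      = ξ * (starRingEnd ℂ) (I₂ Z W) + (starRingEnd ℂ) ξ * I₂ Z W ∧
    deriv (fun t : ℝ =>
      I₁ (Z + (t : ℂ) • Matrix.of fun A B =>
            (1 / 2 : ℂ) * ξ * ∑ C, ∑ D, (eps4 A B C D : ℂ) * (starRingEnd ℂ) (Z C D))
        (W + (t : ℂ) • fun I => (starRingEnd ℂ) ξ * (starRingEnd ℂ) (W I))) 0
      = 2 * (ξ * (starRingEnd ℂ) (I₂ Z W)).re ∧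
    deriv (fun t : ℝ =>
      I₂ (Z + (t : ℂ) • Matrix.of fun A B =>
            (1 / 2 : ℂ) * ξ * ∑ C, ∑ D, (eps4 A B C D : ℂ) * (starRingEnd ℂ) (Z C D))
        (W + (t : ℂ) • fun I => (starRingEnd ℂ) ξ * (starRingEnd ℂ) (W I))) 0
      = 2 * ξ * (I₁ Z W : ℂ) := by
  set X : Matrix (Fin 4) (Fin 4) ℂ := Matrix.of fun A B =>
    (1 / 2 : ℂ) * ξ * ∑ C, ∑ D, (eps4 A B C D : ℂ) * (starRingEnd ℂ) (Z C D) with hX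
  set Y : Fin n → ℂ := fun I => (starRingEnd ℂ) ξ * (starRingEnd ℂ) (W I) with hYdef
  have h1 : deriv (fun t : ℝ => I₁ (Z + (t : ℂ) • X) (W + (t : ℂ) • Y)) 0
      = 2 * (ξ * (starRingEnd ℂ) (I₂ Z W)).re := by
    rw [(hasDerivAt_I₁ Z X W Y).deriv]
    have hZX : ∑ A, ∑ B, X A B * (starRingEnd ℂ) (Z A B) =
        2 * (ξ * (starRingEnd ℂ) ((1 / 4 : ℂ) *
          ∑ A, ∑ B, ∑ C, ∑ D, (eps4 A B C D : ℂ) * Z A B * Z C D)) := by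
      simp only [hX, Matrix.of_apply, map_mul, map_sum, map_intCast, map_div₀, map_one,
        map_ofNat, Finset.mul_sum, Finset.sum_mul]
      refine Finset.sum_congr rfl fun A _ => Finset.sum_congr rfl fun B _ =>
        Finset.sum_congr rfl fun C _ => Finset.sum_congr rfl fun D _ => by ring
    have hWY : ∑ I, Y I * (starRingEnd ℂ) (W I) =
        (starRingEnd ℂ) (ξ * (starRingEnd ℂ)
          (∑ I, (starRingEnd ℂ) (W I) * (starRingEnd ℂ) (W I))) := by
      simp only [hYdef, map_mul, map_sum, Complex.conj_conj, Finset.mul_sum, mul_assoc]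
    rw [hZX, hWY, I₂, map_sub, mul_sub, Complex.sub_re, Complex.sub_re]
    simp only [Complex.conj_re, Complex.mul_re (2 : ℂ), Complex.re_ofNat, Complex.im_ofNat]
    ring
  refine ⟨?_, h1, ?_⟩
  · rw [h1, ← Complex.add_conj]
    simp
  · rw [(hasDerivAt_I₂ Z X W Y).deriv]
    have hZbar : (Z.map (starRingEnd ℂ))ᵀ = -Z.map (starRingEnd ℂ) := by
      rw [← Matrix.transpose_map, hZ]
      ext
      simp
    have hI : (I₁ Z W : ℂ) = (1 / 2 : ℂ) * ∑ A, ∑ B, Z A B * (starRingEnd ℂ) (Z A B)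
        - ∑ I, W I * (starRingEnd ℂ) (W I) := by
      rw [I₁, ← Complex.conj_eq_iff_re]
      simp [mul_comm, map_ofNat]
    have hZX : ∑ A, ∑ B, (∑ C, ∑ D, (eps4 A B C D : ℂ) * Z C D) * X A B =
        2 * ξ * ∑ A, ∑ B, Z A B * (starRingEnd ℂ) (Z A B) := by
      have h := sum_eps4_dual_mul_eps4_dual Z _ hZbar
      simp only [Matrix.map_apply] at h
      simp only [hX, Matrix.of_apply, mul_left_comm _ (1 / 2 * ξ), ← Finset.mul_sum, h]
      ring
    have hWY : ∑ I, (starRingEnd ℂ) (W I) * (starRingEnd ℂ) (Y I) =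
        ξ * ∑ I, W I * (starRingEnd ℂ) (W I) := by
      simp only [hYdef, map_mul, Complex.conj_conj, Finset.mul_sum]
      exact Finset.sum_congr rfl fun I _ => by ring
    rw [hI, hZX, hWY]
    ring
end

section
/- Let Z be a 4×4 antisymmetric complex matrix and Z_I ∈ ℂ (I = 1,…,n), and define the geodesic potential V = (1/2) Σ_{A,B} Z_{AB}·conj(Z_{AB}) + Σ_I Z_I·conj(Z_I). Suppose the attractor conditions hold: Z_I = 0 for all I and Σ ε^{ABCD} Z_{AB} Z_{CD} = 0 (equivalently, the contraction conj(Z_{AB})·conj(Z_{CD})·ε_{ABCD} of the charges with the vielbein component P_{ABCD} = ε_{ABCD} P vanishes). Then V is critical to first order under every combined SU(1,1) × O(6,n) coset variation: for all ξ ∈ ℂ and all complex ξ_{ABI} antisymmetric in A,B with conj(ξ_{ABI}) = (1/2) Σ_{C,D} ε^{ABCD} ξ_{CDI}, setting (δZ)_{AB} = (1/2) ξ Σ_{C,D} ε_{ABCD}·conj(Z_{CD}) + Σ_I ξ_{ABI}·conj(Z_I) and (δZ)_I = conj(ξ)·conj(Z_I) + (1/2) Σ_{A,B} ξ_{ABI}·conj(Z_{AB}),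 one has d/dt V(Z + t·δZ, Z_I + t·(δZ)_I) |_{t=0} = 0 for real t. -/
open Matrix

/-- The geodesic potential `V = (1/2) Σ_{A,B} Z_{AB} conj(Z_{AB}) + Σ_I Z_I conj(Z_I)`
of `N = 4` supergravity. -/
noncomputable def Vpot {n : ℕ} (Z : Matrix (Fin 4) (Fin 4) ℂ) (W : Fin n → ℂ) : ℝ :=
  ((1 / 2 : ℂ) * ∑ A, ∑ B, Z A B * (starRingEnd ℂ) (Z A B)
    + ∑ I, W I * (starRingEnd ℂ) (W I)).re

theorem Vpot_eq_sum_normSq {n : ℕ} (Z : Matrix (Fin 4) (Fin 4) ℂ) (W : Fin n → ℂ) :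
    Vpot Z W = 1 / 2 * ∑ A, ∑ B, Complex.normSq (Z A B) + ∑ I, Complex.normSq (W I) := by
  simp only [Vpot, Complex.mul_conj]
  rw [← Complex.ofReal_re (1 / 2 * ∑ A, ∑ B, Complex.normSq (Z A B) + ∑ I, Complex.normSq (W I))]
  push_cast
  rfl

theorem normSq_add_ofReal_mul (a b : ℂ) (t : ℝ) :
    Complex.normSq (a + t * b) =
      Complex.normSq a + t * (2 * (a * (starRingEnd ℂ) b).re) + t ^ 2 * Complex.normSq b := by
  simp [Complex.normSq_apply]
  ring

theorem Vpot_add_smul {n : ℕ} (Z D : Matrix (Fin 4) (Fin 4) ℂ) (W E : Fin n → ℂ) (t : ℝ) :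
    Vpot (Z + (t : ℂ) • D) (W + (t : ℂ) • E) =
      Vpot Z W
        + t * ((∑ A, ∑ B, Z A B * (starRingEnd ℂ) (D A B)).re
          + 2 * (∑ I, W I * (starRingEnd ℂ) (E I)).re)
        + t ^ 2 * Vpot D E := by
  simp only [Vpot_eq_sum_normSq, Matrix.add_apply, Matrix.smul_apply, Pi.add_apply, Pi.smul_apply,
    smul_eq_mul, normSq_add_ofReal_mul, Finset.sum_add_distrib, ← Finset.mul_sum, Complex.re_sum]
  ring

theorem hasDerivAt_Vpot_add_smul {n : ℕ} (Z D : Matrix (Fin 4) (Fin 4) ℂ) (W E : Fin n → ℂ) :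
    HasDerivAt (fun t : ℝ => Vpot (Z + (t : ℂ) • D) (W + (t : ℂ) • E))
      ((∑ A, ∑ B, Z A B * (starRingEnd ℂ) (D A B)).re
        + 2 * (∑ I, W I * (starRingEnd ℂ) (E I)).re) 0 := by
  simp only [Vpot_add_smul]
  have h := (((hasDerivAt_id (0 : ℝ)).mul_const
    ((∑ A, ∑ B, Z A B * (starRingEnd ℂ) (D A B)).re
      + 2 * (∑ I, W I * (starRingEnd ℂ) (E I)).re)).const_add (Vpot Z W)).add
    (((hasDerivAt_id (0 : ℝ)).pow 2).mul_const (Vpot D E))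
  refine h.congr_deriv ?_
  simp

/-- At the `N = 4` attractor point, where all matter charges vanish and
`Σ ε^{ABCD} Z_{AB} Z_{CD} = 0`, the geodesic potential `V` is critical to first
order under every combined `SU(1,1) × O(6,n)` coset variation
`(δZ)_{AB} = (1/2) ξ Σ ε_{ABCD} conj(Z_{CD}) + Σ_I ξ_{ABI} conj(Z_I)`,
`(δZ)_I = conj(ξ) conj(Z_I) + (1/2) Σ_{A,B} ξ_{ABI} conj(Z_{AB})`. -/
theorem geodesic_potential_critical_at_attractor {n : ℕ}
    (Z : Matrix (Fin 4) (Fin 4) ℂ) (hZ : Zᵀ = -Z) (W : Fin n → ℂ)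
    (hW : ∀ I, W I = 0)
    (hquad : ∑ A, ∑ B, ∑ C, ∑ D, (eps4 A B C D : ℂ) * Z A B * Z C D = 0) :
    ∀ (ξ : ℂ) (ξm : Fin 4 → Fin 4 → Fin n → ℂ),
      (∀ A B I, ξm B A I = -ξm A B I) →
      (∀ A B I, (starRingEnd ℂ) (ξm A B I) =
        (1 / 2 : ℂ) * ∑ C, ∑ D, (eps4 A B C D : ℂ) * ξm C D I) →
      deriv (fun t : ℝ =>
        Vpot (Z + (t : ℂ) • Matrix.of fun A B =>
              (1 / 2 : ℂ) * ξ * (∑ C, ∑ D, (eps4 A B C D : ℂ) * (starRingEnd ℂ) (Z C D))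
                + ∑ I, ξm A B I * (starRingEnd ℂ) (W I))
          (W + (t : ℂ) • fun I => (starRingEnd ℂ) ξ * (starRingEnd ℂ) (W I)
              + (1 / 2 : ℂ) * ∑ A, ∑ B, ξm A B I * (starRingEnd ℂ) (Z A B))) 0 = 0 := by
  intro ξ ξm _ _
  rw [(hasDerivAt_Vpot_add_smul _ _ _ _).deriv]
  have hcross : ∑ A, ∑ B, Z A B * (starRingEnd ℂ) ((1 / 2 : ℂ) * ξ *
      ∑ C, ∑ D, (eps4 A B C D : ℂ) * (starRingEnd ℂ) (Z C D)) = 0 := by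
    rw [← mul_zero ((1 / 2 : ℂ) * (starRingEnd ℂ) ξ), ← hquad]
    simp only [map_mul, map_sum, map_div₀, map_one, map_ofNat, map_intCast, Complex.conj_conj,
      Finset.mul_sum]
    refine Finset.sum_congr rfl fun A _ => Finset.sum_congr rfl fun B _ =>
      Finset.sum_congr rfl fun C _ => Finset.sum_congr rfl fun D _ => ?_
    ring
  simp only [hW, map_zero, mul_zero, zero_mul, Finset.sum_const_zero, add_zero, Matrix.of_apply,
    hcross, Complex.zero_re]
end
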